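/- Let X = (X_t)_{t≥0} and Y = (Y_t)_{t≥0} be processes with values in the standard bases E of ℝ^n and F of ℝ^m respectively; set Z_t = Y_t ⊗ X_t, W_t = Y_{t−1} ⊗ X_t, 𝓕_t = σ(X_0,…,X_t, Y_0,…,Y_t) and 𝓖_t = σ(X_0,…,X_t, Y_0,…,Y_{t−1}). Then the following are equivalent: (i) there exist matrices A (n×n) and G (m×n) such that simultaneously E[Z_{t+1} | 𝓕_t] = Δ(G) A (1_m^T ⊗ I_n) Z_t almost surely for all t AND E[W_{t+1} | 𝓖_t] = (I_m ⊗ A) Δ(G)(1_m^T ⊗ I_n) W_t almost surely for all t ≥ 1 — i.e. (X,Y) is a time-homogeneous stochastic system in both the sense of Picci (Z is 𝓕-Markov with transition depending only on X) and the sense of Van Schuppen (W is 𝓖-Markov with transition depending only on X); (ii) (X,Y) is a hidden Markov chain, i.e. there exist matrices A, G such that E[Z_{t+1} | 𝓕_t] = Δ(G) A (1_m^T ⊗ I_n) Z_t almost surely for all t. -/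

import Mathlib

open MeasureTheory Matrix ProbabilityTheory
open scoped Kronecker

noncomputable section

/-- The `i`-th standard basis vector of `ℝ^n`. -/
def stdBasis (n : ℕ) (i : Fin n) : Fin n → ℝ := fun k => if k = i then 1 else 0

/-- The operator `Δ(G)`: the `(mn) × n` matrix obtained by stacking the diagonal matrices of
the rows of `G`; its `((j,i), k)` entry is `G j i` if `k = i` and `0` otherwise. -/
def deltaOp {m n : ℕ} (G : Matrix (Fin m) (Fin n) ℝ) :
    Matrix (Fin m × Fin n) (Fin n) ℝ :=
  Matrix.of fun p k => if k = p.2 then G p.1 p.2 else 0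

/-- Kronecker product `y ⊗ x` of two vectors (indexed by `Fin m × Fin n`). -/
def vecKron {m n : ℕ} (y : Fin m → ℝ) (x : Fin n → ℝ) : Fin m × Fin n → ℝ :=
  fun p => y p.1 * x p.2

/-- The matrix `1_m^T ⊗ I_n` (after the canonical identification `Fin 1 × Fin n ≃ Fin n`). -/
def onesKronId (m n : ℕ) : Matrix (Fin n) (Fin m × Fin n) ℝ :=
  ((Matrix.of fun (_ : Fin 1) (_ : Fin m) => (1 : ℝ)) ⊗ₖ (1 : Matrix (Fin n) (Fin n) ℝ)).submatrix
    (fun k => ((0 : Fin 1), k)) id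

/-- The σ-algebra generated by `X_0, …, X_t`. -/
def sigmaUpTo {Ω α : Type*} [MeasurableSpace α] (X : ℕ → Ω → α) (t : ℕ) :
    MeasurableSpace Ω :=
  ⨆ s ∈ Finset.Iic t, MeasurableSpace.comap (X s) inferInstance

/-- The σ-algebra `𝓕_t = σ(X_0,…,X_t, Y_0,…,Y_t)`. -/
def filtF {Ω : Type*} {n m : ℕ} (X : ℕ → Ω → Fin n → ℝ) (Y : ℕ → Ω → Fin m → ℝ) (t : ℕ) :
    MeasurableSpace Ω :=
  sigmaUpTo X t ⊔ sigmaUpTo Y t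

/-- The σ-algebra `𝓖_t = σ(X_0,…,X_t, Y_0,…,Y_{t-1})` (so `𝓖_0 = σ(X_0)`). -/
def filtG {Ω : Type*} {n m : ℕ} (X : ℕ → Ω → Fin n → ℝ) (Y : ℕ → Ω → Fin m → ℝ) :
    ℕ → MeasurableSpace Ω
  | 0 => sigmaUpTo X 0
  | (t + 1) => sigmaUpTo X (t + 1) ⊔ sigmaUpTo Y t

variable {Ω : Type*} {mΩ : MeasurableSpace Ω}

/-- `Z = Y ⊗ X` is `𝓕`-Markov with transition matrix `Q = Δ(G) A (1_m^T ⊗ I_n)` (the Picci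
notion of a time-homogeneous stochastic system with transitions depending only on `X`); this is
the definition of `(X, Y)` being a hidden Markov chain with matrices `A`, `G`. -/
def PicciSystem {n m : ℕ} (μ : Measure Ω) (X : ℕ → Ω → Fin n → ℝ) (Y : ℕ → Ω → Fin m → ℝ)
    (A : Matrix (Fin n) (Fin n) ℝ) (G : Matrix (Fin m) (Fin n) ℝ) : Prop :=
  ∀ t, ∀ᵐ ω ∂μ, ∀ p : Fin m × Fin n,
    (μ[fun ω' => vecKron (Y (t + 1) ω') (X (t + 1) ω') p | filtF X Y t]) ω
      = (deltaOp G * A * onesKronId m n).mulVec (vecKron (Y t ω) (X t ω)) p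

/-- `W`, `W_t = Y_{t-1} ⊗ X_t`, is `𝓖`-Markov with transition matrix
`R = (I_m ⊗ A) Δ(G) (1_m^T ⊗ I_n)` (the Van Schuppen notion of a time-homogeneous stochastic
system with transitions depending only on `X`). -/
def VanSchuppenSystem {n m : ℕ} (μ : Measure Ω) (X : ℕ → Ω → Fin n → ℝ)
    (Y : ℕ → Ω → Fin m → ℝ)
    (A : Matrix (Fin n) (Fin n) ℝ) (G : Matrix (Fin m) (Fin n) ℝ) : Prop :=
  ∀ t, ∀ᵐ ω ∂μ, ∀ p : Fin m × Fin n,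
    (μ[fun ω' => vecKron (Y (t + 1) ω') (X (t + 2) ω') p | filtG X Y (t + 1)]) ω
      = (((1 : Matrix (Fin m) (Fin m) ℝ) ⊗ₖ A) * deltaOp G * onesKronId m n).mulVec
          (vecKron (Y t ω) (X (t + 1) ω)) p

/-- If on `s` the σ-algebra `m₂` has the same trace as `m₁`, then for functions vanishing off `s`
an identity of conditional expectations given `m₁` determines the one given `m₂`. -/
lemma condExp_ae_eq_of_comap_le {μ : Measure Ω} [IsFiniteMeasure μ]
    {m₁ m₂ : MeasurableSpace Ω} (hm₁ : m₁ ≤ mΩ) (hm₂ : m₂ ≤ mΩ) {s : Set Ω}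
    (hs : MeasurableSpace.comap ((↑) : s → Ω) m₂ ≤ MeasurableSpace.comap ((↑) : s → Ω) m₁)
    {f g : Ω → ℝ} (hf : Integrable f μ) (hg : Integrable g μ) (hgm : StronglyMeasurable[m₂] g)
    (hfs : ∀ ω ∉ s, f ω = 0) (hgs : ∀ ω ∉ s, g ω = 0) (hfg : μ[f | m₁] =ᵐ[μ] μ[g | m₁]) :
    μ[f | m₂] =ᵐ[μ] g := by
  refine (ae_eq_condExp_of_forall_setIntegral_eq hm₂ hf (fun _ _ _ => hg.integrableOn) ?_
    hgm.aestronglyMeasurable).symm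
  intro a ha _
  obtain ⟨b, hb, hab⟩ := hs _ ⟨a, ha, rfl⟩
  have key : ∀ h : Ω → ℝ, (∀ ω ∉ s, h ω = 0) → ∫ ω in a, h ω ∂μ = ∫ ω in b, h ω ∂μ := by
    intro h h0
    rw [← integral_indicator (hm₂ _ ha), ← integral_indicator (hm₁ _ hb)]
    congr 1
    ext ω
    by_cases hω : ω ∈ s
    · have : ω ∈ b ↔ ω ∈ a := Set.ext_iff.1 hab ⟨ω, hω⟩
      by_cases hωa : ω ∈ a
      · rw [Set.indicator_of_mem hωa, Set.indicator_of_mem (this.2 hωa)]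
      · rw [Set.indicator_of_notMem hωa, Set.indicator_of_notMem (mt this.1 hωa)]
    · simp [Set.indicator, h0 ω hω]
  rw [key g hgs, key f hfs, ← setIntegral_condExp hm₁ hf hb, ← setIntegral_condExp hm₁ hg hb]
  exact setIntegral_congr_ae (hm₁ _ hb) (hfg.symm.mono fun _ h _ => h)

lemma comap_le_sigmaUpTo {α : Type*} [MeasurableSpace α] (X : ℕ → Ω → α) {s t : ℕ} (h : s ≤ t) :
    MeasurableSpace.comap (X s) inferInstance ≤ sigmaUpTo X t :=
  le_iSup₂_of_le s (Finset.mem_Iic.2 h) le_rfl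

lemma sigmaUpTo_mono {α : Type*} [MeasurableSpace α] (X : ℕ → Ω → α) {s t : ℕ} (h : s ≤ t) :
    sigmaUpTo X s ≤ sigmaUpTo X t :=
  iSup₂_le fun _ hr => comap_le_sigmaUpTo X ((Finset.mem_Iic.1 hr).trans h)

lemma sigmaUpTo_le {α : Type*} [MeasurableSpace α] {X : ℕ → Ω → α} (hX : ∀ t, Measurable (X t))
    (t : ℕ) : sigmaUpTo X t ≤ mΩ :=
  iSup₂_le fun s _ => (hX s).comap_le

lemma sigmaUpTo_succ_le {α : Type*} [MeasurableSpace α] (X : ℕ → Ω → α) (t : ℕ) :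
    sigmaUpTo X (t + 1) ≤ sigmaUpTo X t ⊔ MeasurableSpace.comap (X (t + 1)) inferInstance := by
  refine iSup₂_le fun s hs => ?_
  rcases (Finset.mem_Iic.1 hs).eq_or_lt with rfl | h
  · exact le_sup_right
  · exact (comap_le_sigmaUpTo X (Nat.lt_succ_iff.1 h)).trans le_sup_left

section Filtrations

variable {n m : ℕ} {X : ℕ → Ω → Fin n → ℝ} {Y : ℕ → Ω → Fin m → ℝ}

lemma filtF_le (hX : ∀ t, Measurable (X t)) (hY : ∀ t, Measurable (Y t)) (t : ℕ) :
    filtF X Y t ≤ mΩ :=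
  sup_le (sigmaUpTo_le hX t) (sigmaUpTo_le hY t)

lemma filtG_succ_le_filtF (X : ℕ → Ω → Fin n → ℝ) (Y : ℕ → Ω → Fin m → ℝ) (t : ℕ) :
    filtG X Y (t + 1) ≤ filtF X Y (t + 1) :=
  sup_le_sup le_rfl (sigmaUpTo_mono Y t.le_succ)

lemma filtG_succ_le_sup (X : ℕ → Ω → Fin n → ℝ) (Y : ℕ → Ω → Fin m → ℝ) (t : ℕ) :
    filtG X Y (t + 1) ≤ filtF X Y t ⊔ MeasurableSpace.comap (X (t + 1)) inferInstance :=
  sup_le ((sigmaUpTo_succ_le X t).trans (sup_le_sup le_sup_left le_rfl))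
    (le_sup_of_le_left le_sup_right)

lemma stronglyMeasurable_filtG (X : ℕ → Ω → Fin n → ℝ) (Y : ℕ → Ω → Fin m → ℝ) (t : ℕ)
    (i : Fin n) : StronglyMeasurable[filtG X Y (t + 1)] fun ω => X (t + 1) ω i := by
  have h : Measurable[filtG X Y (t + 1)] (X (t + 1)) :=
    measurable_iff_comap_le.2 ((comap_le_sigmaUpTo X le_rfl).trans le_sup_left)
  exact ((measurable_pi_apply i).comp h).stronglyMeasurable

lemma stronglyMeasurable_filtF (X : ℕ → Ω → Fin n → ℝ) (Y : ℕ → Ω → Fin m → ℝ) (t : ℕ)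
    (j : Fin m) : StronglyMeasurable[filtF X Y t] fun ω => Y t ω j := by
  have h : Measurable[filtF X Y t] (Y t) :=
    measurable_iff_comap_le.2 ((comap_le_sigmaUpTo Y le_rfl).trans le_sup_right)
  exact ((measurable_pi_apply j).comp h).stronglyMeasurable

end Filtrations

section Values

variable {n : ℕ} {x : Fin n → ℝ}

lemma sum_eq_one_of_eq_stdBasis (h : ∃ i, x = stdBasis n i) : ∑ k, x k = 1 := by
  obtain ⟨i, rfl⟩ := h
  simp [_root_.stdBasis]

lemma eq_zero_of_ne_stdBasis (h : ∃ i, x = stdBasis n i) {k : Fin n} (hk : x ≠ stdBasis n k) :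
    x k = 0 := by
  obtain ⟨i, rfl⟩ := h
  have : k ≠ i := by rintro rfl; exact hk rfl
  simp [_root_.stdBasis, this]

lemma nonneg_of_eq_stdBasis (h : ∃ i, x = stdBasis n i) (k : Fin n) : 0 ≤ x k := by
  obtain ⟨i, rfl⟩ := h
  simp only [_root_.stdBasis]
  split_ifs <;> norm_num

lemma norm_le_one_of_eq_stdBasis (h : ∃ i, x = stdBasis n i) (k : Fin n) : ‖x k‖ ≤ 1 := by
  obtain ⟨i, rfl⟩ := h
  simp only [_root_.stdBasis]
  split_ifs <;> norm_num

end Values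

section Operators

variable {n m : ℕ} {y : Fin m → ℝ}

lemma onesKronId_mulVec_vecKron (hy : ∑ j, y j = 1) (x : Fin n → ℝ) :
    (onesKronId m n).mulVec (vecKron y x) = x := by
  ext k
  simp [onesKronId, mulVec, dotProduct, vecKron, Fintype.sum_prod_type, one_apply,
    ← Finset.sum_mul, hy]

lemma picci_mulVec (A : Matrix (Fin n) (Fin n) ℝ) (G : Matrix (Fin m) (Fin n) ℝ)
    (hy : ∑ j, y j = 1) (x : Fin n → ℝ) (p : Fin m × Fin n) :
    (deltaOp G * A * onesKronId m n).mulVec (vecKron y x) p = G p.1 p.2 * A.mulVec x p.2 := by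
  rw [← mulVec_mulVec, onesKronId_mulVec_vecKron hy, ← mulVec_mulVec]
  simp [deltaOp, mulVec, dotProduct]

lemma vanSchuppen_mulVec (A : Matrix (Fin n) (Fin n) ℝ) (G : Matrix (Fin m) (Fin n) ℝ)
    (hy : ∑ j, y j = 1) (x : Fin n → ℝ) (p : Fin m × Fin n) :
    (((1 : Matrix (Fin m) (Fin m) ℝ) ⊗ₖ A) * deltaOp G * onesKronId m n).mulVec (vecKron y x) p
      = ∑ k, A p.2 k * (G p.1 k * x k) := by
  rw [← mulVec_mulVec, onesKronId_mulVec_vecKron hy, ← mulVec_mulVec]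
  simp [deltaOp, mulVec, dotProduct, Fintype.sum_prod_type, one_apply, ite_mul]

end Operators

section Systems

variable {n m : ℕ} {μ : Measure Ω} {X : ℕ → Ω → Fin n → ℝ} {Y : ℕ → Ω → Fin m → ℝ}
  {A : Matrix (Fin n) (Fin n) ℝ} {G : Matrix (Fin m) (Fin n) ℝ}

lemma picciSystem_iff (hYval : ∀ t ω, ∃ j, Y t ω = stdBasis m j) :
    PicciSystem μ X Y A G ↔ ∀ t j i,
      μ[fun ω => Y (t + 1) ω j * X (t + 1) ω i | filtF X Y t]
        =ᵐ[μ] fun ω => G j i * A.mulVec (X t ω) i := by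
  simp only [PicciSystem, ae_all_iff, Prod.forall,
    picci_mulVec A G (sum_eq_one_of_eq_stdBasis (hYval _ _))]
  rfl

lemma vanSchuppenSystem_iff (hYval : ∀ t ω, ∃ j, Y t ω = stdBasis m j) :
    VanSchuppenSystem μ X Y A G ↔ ∀ t j i,
      μ[fun ω => Y (t + 1) ω j * X (t + 2) ω i | filtG X Y (t + 1)]
        =ᵐ[μ] fun ω => ∑ k, A i k * (G j k * X (t + 1) ω k) := by
  simp only [VanSchuppenSystem, ae_all_iff, Prod.forall,
    vanSchuppen_mulVec A G (sum_eq_one_of_eq_stdBasis (hYval _ _))]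
  rfl

variable [IsProbabilityMeasure μ]

lemma integrable_coord (hXmeas : ∀ t, Measurable (X t))
    (hXval : ∀ t ω, ∃ i, X t ω = stdBasis n i) (t : ℕ) (i : Fin n) :
    Integrable (fun ω => X t ω i) μ :=
  Integrable.of_bound ((measurable_pi_apply i).comp (hXmeas t)).aestronglyMeasurable 1
    (.of_forall fun ω => norm_le_one_of_eq_stdBasis (hXval t ω) i)

lemma integrable_mul_coord (hXmeas : ∀ t, Measurable (X t)) (hYmeas : ∀ t, Measurable (Y t))
    (hXval : ∀ t ω, ∃ i, X t ω = stdBasis n i) (hYval : ∀ t ω, ∃ j, Y t ω = stdBasis m j)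
    (s t : ℕ) (j : Fin m) (i : Fin n) : Integrable (fun ω => Y s ω j * X t ω i) μ :=
  (integrable_coord hXmeas hXval t i).bdd_mul
    ((measurable_pi_apply j).comp (hYmeas s)).aestronglyMeasurable (c := 1)
    (.of_forall fun ω => norm_le_one_of_eq_stdBasis (hYval s ω) j)

lemma PicciSystem.condExp_coord (h : PicciSystem μ X Y A G)
    (hXmeas : ∀ t, Measurable (X t)) (hYmeas : ∀ t, Measurable (Y t))
    (hXval : ∀ t ω, ∃ i, X t ω = stdBasis n i) (hYval : ∀ t ω, ∃ j, Y t ω = stdBasis m j)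
    (t : ℕ) (i : Fin n) :
    μ[fun ω => X (t + 1) ω i | filtF X Y t]
      =ᵐ[μ] fun ω => (∑ j, G j i) * A.mulVec (X t ω) i := by
  have hX : (fun ω => X (t + 1) ω i) = ∑ j, fun ω => Y (t + 1) ω j * X (t + 1) ω i := by
    ext ω
    simp [← Finset.sum_mul, sum_eq_one_of_eq_stdBasis (hYval (t + 1) ω)]
  rw [hX]
  refine (condExp_finsetSum
    (fun j _ => integrable_mul_coord hXmeas hYmeas hXval hYval _ _ j i) _).trans ?_
  filter_upwards [ae_all_iff.2 fun j => (picciSystem_iff hYval).1 h t j i] with ω hω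
  simp [hω, Finset.sum_mul]

/-- The matrices of a hidden Markov chain can be chosen such that `A` is the matrix of transition
probabilities of `X`. -/
lemma PicciSystem.exists_normalized (h : PicciSystem μ X Y A G)
    (hXmeas : ∀ t, Measurable (X t)) (hYmeas : ∀ t, Measurable (Y t))
    (hXval : ∀ t ω, ∃ i, X t ω = stdBasis n i) (hYval : ∀ t ω, ∃ j, Y t ω = stdBasis m j) :
    ∃ (A' : Matrix (Fin n) (Fin n) ℝ) (G' : Matrix (Fin m) (Fin n) ℝ),
      PicciSystem μ X Y A' G' ∧ ∀ t i, μ[fun ω => X (t + 1) ω i | filtF X Y t]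
        =ᵐ[μ] fun ω => A'.mulVec (X t ω) i := by
  have hmul : ∀ (x : Fin n → ℝ) (i : Fin n),
      (Matrix.of fun i k => (∑ j, G j i) * A i k).mulVec x i = (∑ j, G j i) * A.mulVec x i := by
    intro x i
    simp [mulVec, dotProduct, Finset.mul_sum, mul_assoc]
  have hcoord := h.condExp_coord hXmeas hYmeas hXval hYval
  refine ⟨Matrix.of fun i k => (∑ j, G j i) * A i k, Matrix.of fun j i => G j i / ∑ l, G l i,
    (picciSystem_iff hYval).2 fun t j i => ?_, fun t i => by simpa only [hmul] using hcoord t i⟩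
  simp only [hmul, of_apply]
  by_cases hi : ∑ l, G l i = 0
  · have h0 : (fun ω => X (t + 1) ω i) =ᵐ[μ] 0 := by
      rw [← integral_eq_zero_iff_of_nonneg
        (fun ω => nonneg_of_eq_stdBasis (hXval (t + 1) ω) i) (integrable_coord hXmeas hXval _ i),
        ← integral_condExp (filtF_le hXmeas hYmeas t), integral_congr_ae (hcoord t i)]
      simp [hi]
    have h1 : (fun ω => Y (t + 1) ω j * X (t + 1) ω i) =ᵐ[μ] 0 := by
      filter_upwards [h0] with ω hω
      simp_all
    refine (condExp_congr_ae h1).trans ?_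
    rw [condExp_zero]
    exact .of_forall fun ω => by simp [hi]
  · filter_upwards [(picciSystem_iff hYval).1 h t j i] with ω hω
    rw [hω]
    field_simp

/-- The conditional law of `Y_{t+1}` given the past and `X_{t+1}` depends on `X_{t+1}` only. -/
lemma PicciSystem.condExp_filtG (h : PicciSystem μ X Y A G)
    (hA : ∀ t i, μ[fun ω => X (t + 1) ω i | filtF X Y t] =ᵐ[μ] fun ω => A.mulVec (X t ω) i)
    (hXmeas : ∀ t, Measurable (X t)) (hYmeas : ∀ t, Measurable (Y t))
    (hXval : ∀ t ω, ∃ i, X t ω = stdBasis n i) (hYval : ∀ t ω, ∃ j, Y t ω = stdBasis m j)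
    (t : ℕ) (j : Fin m) (k : Fin n) :
    μ[fun ω => Y (t + 1) ω j * X (t + 1) ω k | filtG X Y (t + 1)]
      =ᵐ[μ] fun ω => G j k * X (t + 1) ω k := by
  have h0 : ∀ ω ∉ {ω | X (t + 1) ω = stdBasis n k}, X (t + 1) ω k = 0 :=
    fun ω hω => eq_zero_of_ne_stdBasis (hXval _ ω) hω
  refine condExp_ae_eq_of_comap_le (filtF_le hXmeas hYmeas t)
    ((filtG_succ_le_filtF X Y t).trans (filtF_le hXmeas hYmeas _))
    (s := {ω | X (t + 1) ω = stdBasis n k}) ?_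
    (integrable_mul_coord hXmeas hYmeas hXval hYval _ _ j k)
    ((integrable_coord hXmeas hXval (t + 1) k).const_mul (G j k))
    ((stronglyMeasurable_filtG X Y t k).const_mul _)
    (fun ω hω => by simp only [h0 ω hω, mul_zero]) (fun ω hω => by simp only [h0 ω hω, mul_zero]) ?_
  · refine (MeasurableSpace.comap_mono (filtG_succ_le_sup X Y t)).trans ?_
    rw [MeasurableSpace.comap_sup, MeasurableSpace.comap_comp]
    refine sup_le le_rfl ?_
    have : X (t + 1) ∘ ((↑) : {ω | X (t + 1) ω = stdBasis n k} → Ω) = fun _ => stdBasis n k :=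
      funext fun ω => ω.2
    rw [this, MeasurableSpace.comap_const]
    exact bot_le
  · have h2 := condExp_smul (μ := μ) (G j k) (fun ω => X (t + 1) ω k) (filtF X Y t)
    refine ((picciSystem_iff hYval).1 h t j k).trans (.symm (h2.trans ?_))
    filter_upwards [hA t k] with ω hω
    simp [hω]

lemma PicciSystem.vanSchuppenSystem (h : PicciSystem μ X Y A G)
    (hA : ∀ t i, μ[fun ω => X (t + 1) ω i | filtF X Y t] =ᵐ[μ] fun ω => A.mulVec (X t ω) i)
    (hXmeas : ∀ t, Measurable (X t)) (hYmeas : ∀ t, Measurable (Y t))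
    (hXval : ∀ t ω, ∃ i, X t ω = stdBasis n i) (hYval : ∀ t ω, ∃ j, Y t ω = stdBasis m j) :
    VanSchuppenSystem μ X Y A G := by
  refine (vanSchuppenSystem_iff hYval).2 fun t j i => ?_
  have hF : μ[fun ω => Y (t + 1) ω j * X (t + 2) ω i | filtF X Y (t + 1)]
      =ᵐ[μ] ∑ k, A i k • fun ω => Y (t + 1) ω j * X (t + 1) ω k := by
    refine (condExp_mul_of_stronglyMeasurable_left (stronglyMeasurable_filtF X Y (t + 1) j)
      (integrable_mul_coord hXmeas hYmeas hXval hYval _ _ j i)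
      (integrable_coord hXmeas hXval (t + 2) i)).trans ?_
    filter_upwards [hA (t + 1) i] with ω hω
    simp [hω, mulVec, dotProduct, Finset.mul_sum, mul_left_comm]
  refine (condExp_condExp_of_le (filtG_succ_le_filtF X Y t)
    (filtF_le hXmeas hYmeas (t + 1))).symm.trans ((condExp_congr_ae hF).trans ?_)
  refine (condExp_finsetSum (fun k _ =>
    (integrable_mul_coord hXmeas hYmeas hXval hYval _ _ j k).smul (A i k)) _).trans ?_
  filter_upwards [
    ae_all_iff.2 fun k => condExp_smul (μ := μ) (A i k)
      (fun ω => Y (t + 1) ω j * X (t + 1) ω k) (filtG X Y (t + 1)),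
    ae_all_iff.2 fun k => h.condExp_filtG hA hXmeas hYmeas hXval hYval t j k] with ω h1 h2
  simp [h1, h2]

end Systems

/-- A pair `(X, Y)` of finite-valued processes is a time-homogeneous
stochastic system in both the sense of Picci and the sense of Van Schuppen (for some matrices
`A`, `G`) if and only if it is a hidden Markov chain (for some matrices `A`, `G`). -/
theorem picci_and_vanSchuppen_iff_hmc {n m : ℕ}
    (μ : Measure Ω) [IsProbabilityMeasure μ]
    (X : ℕ → Ω → Fin n → ℝ) (Y : ℕ → Ω → Fin m → ℝ)
    (hXmeas : ∀ t, Measurable (X t)) (hYmeas : ∀ t, Measurable (Y t))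
    (hXval : ∀ t ω, ∃ i, X t ω = stdBasis n i)
    (hYval : ∀ t ω, ∃ j, Y t ω = stdBasis m j) :
    (∃ (A : Matrix (Fin n) (Fin n) ℝ) (G : Matrix (Fin m) (Fin n) ℝ),
        PicciSystem μ X Y A G ∧ VanSchuppenSystem μ X Y A G)
    ↔
    (∃ (A : Matrix (Fin n) (Fin n) ℝ) (G : Matrix (Fin m) (Fin n) ℝ),
        PicciSystem μ X Y A G) := by
  constructor
  · rintro ⟨A, G, h, -⟩
    exact ⟨A, G, h⟩
  · rintro ⟨A, G, h⟩
    obtain ⟨A', G', h', hA'⟩ := h.exists_normalized hXmeas hYmeas hXval hYval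
    exact ⟨A', G', h', h'.vanSchuppenSystem hA' hXmeas hYmeas hXval hYval⟩
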